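/- Every Bézout duo-domain of Gelfand range 1 is an elementary divisor ring; that is, if R is a Bézout duo-domain such that whenever aR + bR = R there exists y ∈ R with R/(a + by)R a PM ring, then R is an elementary divisor ring. -/

import Mathlib

/-- A (not necessarily square) matrix `A` over a ring admits diagonal reduction if there are
invertible matrices `P`, `Q` such that `P * A * Q` is a diagonal matrix `(d_ij)` in which each
diagonal entry `d_{i+1,i+1}` is a full divisor of `d_ii`, i.e.
`R·d_{i+1,i+1}·R ⊆ d_ii·R ∩ R·d_ii`. -/
def AdmitsDiagonalReduction {R : Type*} [Ring R] {m n : ℕ}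
    (A : Matrix (Fin m) (Fin n) R) : Prop :=
  ∃ (P : Matrix (Fin m) (Fin m) R) (Q : Matrix (Fin n) (Fin n) R),
    IsUnit P ∧ IsUnit Q ∧
    (∀ (i : Fin m) (j : Fin n), (i : ℕ) ≠ (j : ℕ) → (P * A * Q) i j = 0) ∧
    (∀ (i : Fin m) (j : Fin n) (i' : Fin m) (j' : Fin n),
      (i : ℕ) = (j : ℕ) → (i' : ℕ) = (j' : ℕ) → (i' : ℕ) = (i : ℕ) + 1 →
      ∀ x y : R,
        (∃ u : R, x * (P * A * Q) i' j' * y = (P * A * Q) i j * u) ∧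
        (∃ v : R, x * (P * A * Q) i' j' * y = v * (P * A * Q) i j))

/-- A ring is an elementary divisor ring if every matrix admits a diagonal reduction. -/
def ElementaryDivisorRing (R : Type*) [Ring R] : Prop :=
  ∀ (m n : ℕ) (A : Matrix (Fin m) (Fin n) R), AdmitsDiagonalReduction A

/-- A ring is Bézout if every finitely generated left ideal and every finitely generated
right ideal is principal. (Right ideals are submodules of `R` over `Rᵐᵒᵖ`.) -/
def IsBezoutRing (R : Type*) [Ring R] : Prop :=
  (∀ I : Ideal R, I.FG → ∃ d : R, I = Ideal.span {d}) ∧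
  (∀ I : Submodule Rᵐᵒᵖ R, I.FG → ∃ d : R, I = Submodule.span Rᵐᵒᵖ {d})

/-- A ring is duo if every left ideal and every right ideal is two-sided. -/
def IsDuoRing (R : Type*) [Ring R] : Prop :=
  (∀ (I : Ideal R), ∀ a ∈ I, ∀ r : R, a * r ∈ I) ∧
  (∀ (I : Submodule Rᵐᵒᵖ R), ∀ a ∈ I, ∀ r : R, r * a ∈ I)

/-- A ring is left quasi-duo if every maximal left ideal is two-sided. -/
def IsLeftQuasiDuo (R : Type*) [Ring R] : Prop :=
  ∀ I : Ideal R, I.IsMaximal → ∀ a ∈ I, ∀ r : R, a * r ∈ I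

/-- A ring is right quasi-duo if every maximal right ideal is two-sided. -/
def IsRightQuasiDuo (R : Type*) [Ring R] : Prop :=
  ∀ I : Submodule Rᵐᵒᵖ R, IsCoatom I → ∀ a ∈ I, ∀ r : R, r * a ∈ I

/-- A ring has stable range 1 if `aR + bR = R` implies `a + by` is a unit for some `y`. -/
def HasStableRange1 (R : Type*) [Ring R] : Prop :=
  ∀ a b : R, (∃ x y : R, a * x + b * y = 1) → ∃ y : R, IsUnit (a + b * y)

/-- The quotient ring `R/aR`, where `aR` is regarded as the two-sided ideal generated
by `a` (in a duo ring this coincides with the right ideal `aR`). -/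
abbrev QuotBy {R : Type*} [Ring R] (a : R) : Type _ :=
  (TwoSidedIdeal.span {a}).ringCon.Quotient

/-- The Jacobson radical of `R` (the intersection of all maximal left ideals). -/
noncomputable abbrev jacobsonRadical (R : Type*) [Ring R] : Ideal R :=
  Ideal.jacobson (⊥ : Ideal R)

/-- A two-sided ideal `P` is prime if `P ≠ R` and `aRb ⊆ P` implies `a ∈ P` or `b ∈ P`. -/
def IsPrimeTwoSided {R : Type*} [Ring R] (P : TwoSidedIdeal R) : Prop :=
  P ≠ ⊤ ∧ ∀ a b : R, (∀ r : R, a * r * b ∈ P) → a ∈ P ∨ b ∈ P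

/-- A ring is a PM ring if every prime two-sided ideal is contained in exactly one
maximal (two-sided) ideal. -/
def IsPMRing (R : Type*) [Ring R] : Prop :=
  ∀ P : TwoSidedIdeal R, IsPrimeTwoSided P →
    ∃! M : TwoSidedIdeal R, IsCoatom M ∧ P ≤ M

/-- An element `c` is adequate if for every `a` there are `r, s` with `c = rs`,
`rR + aR = R`, and `s'R + aR ≠ R` for every non-invertible divisor `s'` of `s`. -/
def IsAdequateElement {R : Type*} [Ring R] (c : R) : Prop :=
  ∀ a : R, ∃ r s : R, c = r * s ∧ (∃ x y : R, r * x + a * y = 1) ∧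
    ∀ s' : R, ¬ IsUnit s' → (∃ u : R, s = s' * u) → ¬ ∃ x y : R, s' * x + a * y = 1

/-- An element `c` is feckly adequate if for every `a` there are `r, s` with
`c ≡ rs (mod J(R))`, `rR + aR = R`, and `s'R + aR ≠ R` for every non-invertible
divisor `s'` of `s`. -/
def IsFecklyAdequateElement {R : Type*} [Ring R] (c : R) : Prop :=
  ∀ a : R, ∃ r s : R, c - r * s ∈ jacobsonRadical R ∧ (∃ x y : R, r * x + a * y = 1) ∧
    ∀ s' : R, ¬ IsUnit s' → (∃ u : R, s = s' * u) → ¬ ∃ x y : R, s' * x + a * y = 1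


/-- Elementary consequences of the Bézout and duo conditions. -/
structure BD (R : Type*) [Ring R] : Prop where
  hR : ∀ x r : R, ∃ r', r * x = x * r'
  hL : ∀ x r : R, ∃ r', x * r = r' * x
  gcd : ∀ x y : R, ∃ g x' y' α β : R, x = x' * g ∧ y = y' * g ∧ α * x + β * y = g

theorem BD.of {R : Type*} [Ring R] (hB : IsBezoutRing R) (hD : IsDuoRing R) : BD R := by
  refine ⟨fun x r => ?_, fun x r => ?_, fun x y => ?_⟩
  · have := hD.2 (Submodule.span Rᵐᵒᵖ {x}) x (Submodule.mem_span_singleton_self x) r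
    obtain ⟨t, ht⟩ := Submodule.mem_span_singleton.1 this
    exact ⟨t.unop, by rw [← ht]; rfl⟩
  · have := hD.1 (Ideal.span {x}) x (Ideal.mem_span_singleton_self x) r
    obtain ⟨t, ht⟩ := Ideal.mem_span_singleton'.1 this
    exact ⟨t, ht.symm⟩
  · obtain ⟨g, hg⟩ := hB.1 (Ideal.span {x, y}) (Submodule.fg_span (by simp))
    have h1 : x ∈ Ideal.span {g} := hg ▸ Ideal.subset_span (by simp)
    have h2 : y ∈ Ideal.span {g} := hg ▸ Ideal.subset_span (by simp)
    have h3 : g ∈ Ideal.span {x, y} := hg ▸ Ideal.mem_span_singleton_self g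
    obtain ⟨x', hx⟩ := Ideal.mem_span_singleton'.1 h1
    obtain ⟨y', hy⟩ := Ideal.mem_span_singleton'.1 h2
    obtain ⟨α, β, h⟩ := Ideal.mem_span_pair.1 h3
    exact ⟨g, x', y', α, β, hx.symm, hy.symm, h⟩

theorem BD.twoSided {R : Type*} [Ring R] (h : BD R) (I : Ideal R) : I.IsTwoSided := by
  constructor
  intro a b ha
  obtain ⟨t, ht⟩ := h.hL a b
  rw [ht]
  exact I.mul_mem_left _ ha

section
variable {R : Type*} [Ring R] [IsDomain R]

theorem BD.gcd_coprime (H : BD R) (x y : R) : ∃ g x' y' α β : R, x = x' * g ∧ y = y' * g ∧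
    α * x' + β * y' = 1 := by
  obtain ⟨g, x', y', α, β, hx, hy, h⟩ := H.gcd x y
  by_cases hg : g = 0
  · refine ⟨0, 1, 0, 1, 0, ?_, ?_, ?_⟩ <;> simp [hx, hy, hg]
  · refine ⟨g, x', y', α, β, hx, hy, ?_⟩
    apply mul_right_cancel₀ hg
    rw [add_mul, mul_assoc, mul_assoc, ← hx, ← hy, h, one_mul]

theorem BD.comm_aux (H : BD R) {p q α β : R} (h : α * p + β * q = 1) :
    ∃ e, q * p = e * (p * q) := by
  obtain ⟨r, hr⟩ := H.hR p q
  obtain ⟨c, hc⟩ := H.hL q p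
  obtain ⟨d, hd⟩ := H.hL q r
  have h1 : r = (α * c + β * d) * q := by
    calc r = (α * p + β * q) * r := by rw [h, one_mul]
      _ = α * (p * r) + β * (q * r) := by noncomm_ring
      _ = _ := by rw [← hr, hc, hd]; noncomm_ring
  obtain ⟨e, he⟩ := H.hL p (α * c + β * d)
  refine ⟨e, ?_⟩
  rw [hr, h1, ← mul_assoc, he, mul_assoc]

theorem BD.comm (H : BD R) {p q α β : R} (h : α * p + β * q = 1) :
    ∃ e f, e * f = 1 ∧ f * e = 1 ∧ q * p = e * (p * q) := by
  obtain ⟨e, he⟩ := H.comm_aux h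
  obtain ⟨f, hf⟩ := H.comm_aux (p := q) (q := p) (α := β) (β := α) (by rw [add_comm, h])
  by_cases h0 : p * q = 0
  · refine ⟨1, 1, by simp, by simp, ?_⟩
    rw [he, h0]; simp
  · have : f * e = 1 := by
      apply mul_right_cancel₀ h0
      rw [mul_assoc, ← he, ← hf, one_mul]
    exact ⟨e, f, mul_eq_one_symm this, this, he⟩

theorem BD.colHermite (H : BD R) (z1 z2 : R) :
    ∃ g11 g12 g21 g22 h11 h12 h21 h22 k : R,
      z1 = g11 * k ∧ z2 = g21 * k ∧
      h11 * g11 + h12 * g21 = 1 ∧ h11 * g12 + h12 * g22 = 0 ∧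
      h21 * g11 + h22 * g21 = 0 ∧ h21 * g12 + h22 * g22 = 1 ∧
      g11 * h11 + g12 * h21 = 1 ∧ g11 * h12 + g12 * h22 = 0 ∧
      g21 * h11 + g22 * h21 = 0 ∧ g21 * h12 + g22 * h22 = 1 := by
  obtain ⟨k, p, q, α, β, hz1, hz2, h⟩ := H.gcd_coprime z1 z2
  obtain ⟨e, f, hef, hfe, hc⟩ := H.comm h
  obtain ⟨α', hα⟩ := H.hR p α
  obtain ⟨β', hβ⟩ := H.hR q β
  obtain ⟨f', hf⟩ := H.hR p f
  have inj : ∀ v1 v2 : R, α * v1 + β * v2 = 0 → q * v1 + (-(e * p)) * v2 = 0 → v1 = 0 ∧ v2 = 0 := by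
    intro v1 v2 h1 h2
    by_cases hp : p = 0
    · have hbq : β * q = 1 := by simpa [hp] using h
      have hq : q ≠ 0 := fun h0 => by simp [h0] at hbq
      have hb : β ≠ 0 := fun h0 => by simp [h0] at hbq
      have : v1 = 0 := by simpa [hp, hq] using h2
      refine ⟨this, ?_⟩
      simpa [this, hb] using h1
    · have h2' : q * v1 = e * p * v2 := by
        rw [neg_mul, ← sub_eq_add_neg, sub_eq_zero] at h2; exact h2
      obtain ⟨c, hc1⟩ := H.hL p v1
      obtain ⟨d, hd1⟩ := H.hL p v2
      have h3 : v1 = (α * c + β * e * d) * p := by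
        calc v1 = (α * p + β * q) * v1 := by rw [h, one_mul]
          _ = α * (p * v1) + β * (q * v1) := by noncomm_ring
          _ = α * (p * v1) + β * e * (p * v2) := by rw [h2']; noncomm_ring
          _ = _ := by rw [hc1, hd1]; noncomm_ring
      obtain ⟨t, ht⟩ := H.hR p (α * c + β * e * d)
      rw [ht] at h3
      have he : e ≠ 0 := fun h0 => by simp [h0] at hef
      have h4 : v2 = q * t := by
        apply mul_left_cancel₀ (mul_ne_zero he hp)
        rw [← h2', h3, ← mul_assoc, hc]; noncomm_ring
      have ht0 : t = 0 := by
        rw [h3, h4] at h1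
        calc t = (α * p + β * q) * t := by rw [h, one_mul]
          _ = α * (p * t) + β * (q * t) := by noncomm_ring
          _ = 0 := h1
      simp [h3, h4, ht0]
  set s := α * β' + β * (-(f' * α')) with hs
  set u := β' - p * s with hu
  set w := -(f' * α') - q * s with hw
  have e1 : α * p + β * q = 1 := h
  have e2 : α * u + β * w = 0 := by
    calc α * u + β * w = s - (α * p + β * q) * s := by rw [hu, hw, hs]; noncomm_ring
      _ = 0 := by rw [h]; simp
  have e3 : q * p + (-(e * p)) * q = 0 := by rw [hc]; noncomm_ring
  have e4 : q * u + (-(e * p)) * w = 1 := by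
    calc q * u + (-(e * p)) * w = q * β' + e * (p * f') * α' - (q * p + (-(e * p)) * q) * s := by
          rw [hu, hw]; noncomm_ring
      _ = q * β' + (e * f) * (p * α') := by rw [e3, ← hf]; noncomm_ring
      _ = 1 := by rw [hef, ← hα, ← hβ, one_mul, add_comm, h]
  have c1 := inj (p * α + u * q - 1) (q * α + w * q) (by
      calc _ = (α * p + β * q) * α + (α * u + β * w) * q - α := by noncomm_ring
        _ = 0 := by rw [e1, e2]; simp) (by
      calc _ = (q * p + (-(e * p)) * q) * α + (q * u + (-(e * p)) * w) * q - q := by noncomm_ring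
        _ = 0 := by rw [e3, e4]; simp)
  have c2 := inj (p * β + u * (-(e * p))) (q * β + w * (-(e * p)) - 1) (by
      calc _ = (α * p + β * q) * β + (α * u + β * w) * (-(e * p)) - β := by noncomm_ring
        _ = 0 := by rw [e1, e2]; simp) (by
      calc _ = (q * p + (-(e * p)) * q) * β + (q * u + (-(e * p)) * w) * (-(e * p)) - (-(e * p)) := by noncomm_ring
        _ = 0 := by rw [e3, e4]; simp)
  exact ⟨p, u, q, w, α, β, q, -(e * p), k, hz1, hz2, e1, e2, e3, e4, sub_eq_zero.1 c1.1,
    c2.1, c1.2, sub_eq_zero.1 c2.2⟩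

end


theorem wl_abstract {S : Type*} [Ring S] (hL : ∀ x r : S, ∃ r', x * r = r' * x)
    (r rh s sh g11 g12 g21 g22 h11 h12 h21 h22 k : S)
    (hr : r * rh = 1)
    (hz1 : rh * (1 - sh * s) = g11 * k) (hz2 : s * (1 + (1 - sh * s)) = g21 * k)
    (e1 : g11 * h11 + g12 * h21 = 1) (e2 : g11 * h12 + g12 * h22 = 0)
    (e3 : g21 * h11 + g22 * h21 = 0) (e4 : g21 * h12 + g22 * h22 = 1) :
    ∃ u, (s * (1 + (1 - sh * s)) * r * g12 - (1 - s * sh) * g22) * u = 1 := by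
  have y1 : (s * (1 + (1 - sh * s)) * r * g11 - (1 - s * sh) * g21) * k = 0 := by
    calc _ = s * (1 + (1 - sh * s)) * r * (g11 * k) - (1 - s * sh) * (g21 * k) := by noncomm_ring
      _ = s * (1 + (1 - sh * s)) * (r * rh) * (1 - sh * s)
          - (1 - s * sh) * (s * (1 + (1 - sh * s))) := by
        rw [← hz1, ← hz2]; noncomm_ring
      _ = 0 := by rw [hr]; noncomm_ring
  have y2 : ((1 - sh * s) * r * g11 + sh * g21) * k = 1 := by
    calc _ = (1 - sh * s) * r * (g11 * k) + sh * (g21 * k) := by noncomm_ring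
      _ = (1 - sh * s) * (r * rh) * (1 - sh * s) + sh * (s * (1 + (1 - sh * s))) := by
        rw [← hz1, ← hz2]; noncomm_ring
      _ = 1 := by rw [hr]; noncomm_ring
  have y3 : s * (1 + (1 - sh * s)) * r * g11 - (1 - s * sh) * g21 = 0 := by
    obtain ⟨t, ht⟩ := hL ((1 - sh * s) * r * g11 + sh * g21) k
    -- a right inverse of `k`
    obtain ⟨t', ht'⟩ : ∃ t', k * t' = 1 := by
      have hz : ∃ l, ((1 - sh * s) * r * g11 + sh * g21) * k = 1 ∧
        l * ((1 - sh * s) * r * g11 + sh * g21) = 1 := ⟨t, y2, by rw [← ht, y2]⟩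
      obtain ⟨l, hl1, hl2⟩ := hz
      refine ⟨(1 - sh * s) * r * g11 + sh * g21, ?_⟩
      have : l = k := by
        calc l = l * (((1 - sh * s) * r * g11 + sh * g21) * k) := by rw [hl1, mul_one]
          _ = k := by rw [← mul_assoc, hl2, one_mul]
      rw [← this, hl2]
    calc _ = (s * (1 + (1 - sh * s)) * r * g11 - (1 - s * sh) * g21) * (k * t') := by
          rw [ht', mul_one]
      _ = 0 := by rw [← mul_assoc, y1, zero_mul]
  refine ⟨h21 * (rh * sh) - h22 * (1 - s * sh), ?_⟩
  have f1 : g12 * h21 = 1 - g11 * h11 := by rw [← e1]; abel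
  have f2 : g12 * h22 = - (g11 * h12) := by rw [eq_neg_iff_add_eq_zero, add_comm]; exact e2
  have f3 : g22 * h21 = - (g21 * h11) := by rw [eq_neg_iff_add_eq_zero, add_comm]; exact e3
  have f4 : g22 * h22 = 1 - g21 * h12 := by rw [← e4]; abel
  generalize hX : s * (1 + (1 - sh * s)) = X at *
  generalize hE : 1 - s * sh = E at *
  calc (X * r * g12 - E * g22) * (h21 * (rh * sh) - h22 * E)
      = X * r * (g12 * h21) * (rh * sh) - X * r * (g12 * h22) * E - E * (g22 * h21) * (rh * sh)
        + E * (g22 * h22) * E := by noncomm_ring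
    _ = X * (r * rh) * sh + E * E - (X * r * g11 - E * g21) * (h11 * (rh * sh) - h12 * E) := by
        rw [f1, f2, f3, f4]; noncomm_ring
    _ = X * sh + E * E := by rw [y3, hr]; noncomm_ring
    _ = 1 := by rw [← hX, ← hE]; noncomm_ring

section
variable {R : Type*} [Ring R] [∀ I : Ideal R, I.IsTwoSided]

/-- The quotient map modulo `a`. -/
noncomputable abbrev qm (a : R) : R →+* (R ⧸ Ideal.span ({a} : Set R)) :=
  Ideal.Quotient.mk (Ideal.span ({a} : Set R))

theorem qm_eq_zero {a x : R} : qm a x = 0 ↔ x ∈ Ideal.span {a} :=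
  Ideal.Quotient.eq_zero_iff_mem

theorem BD.qL (H : BD R) (a : R) (x r : R ⧸ Ideal.span ({a} : Set R)) :
    ∃ r', x * r = r' * x := by
  obtain ⟨x, rfl⟩ := Ideal.Quotient.mk_surjective x
  obtain ⟨r, rfl⟩ := Ideal.Quotient.mk_surjective r
  obtain ⟨t, ht⟩ := H.hL x r
  exact ⟨qm a t, by rw [← map_mul, ht, map_mul]⟩

theorem BD.qR (H : BD R) (a : R) (x r : R ⧸ Ideal.span ({a} : Set R)) :
    ∃ r', r * x = x * r' := by
  obtain ⟨x, rfl⟩ := Ideal.Quotient.mk_surjective x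
  obtain ⟨r, rfl⟩ := Ideal.Quotient.mk_surjective r
  obtain ⟨t, ht⟩ := H.hR x r
  exact ⟨qm a t, by rw [← map_mul, ht, map_mul]⟩

theorem BD.um_of_right (H : BD R) {a : R} {x y : R ⧸ Ideal.span ({a} : Set R)} (h : x * y = 1) :
    IsUnit x := by
  obtain ⟨t, ht⟩ := H.qL a x y
  rw [h] at ht
  exact isUnit_iff_exists_and_exists.2 ⟨⟨y, h⟩, ⟨t, ht.symm⟩⟩

theorem BD.um_of_left (H : BD R) {a : R} {x y : R ⧸ Ideal.span ({a} : Set R)} (h : y * x = 1) :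
    IsUnit x := by
  obtain ⟨t, ht⟩ := H.qR a x y
  rw [h] at ht
  exact H.um_of_right ht.symm

theorem BD.um_left (H : BD R) {a : R} {x y : R ⧸ Ideal.span ({a} : Set R)} (h : IsUnit (x * y)) :
    IsUnit x := by
  obtain ⟨t, ht⟩ := h.exists_right_inv
  exact H.um_of_right (y := y * t) (by rw [← mul_assoc, ht])

theorem BD.um_right (H : BD R) {a : R} {x y : R ⧸ Ideal.span ({a} : Set R)} (h : IsUnit (x * y)) :
    IsUnit y := by
  obtain ⟨t, ht⟩ := h.exists_left_inv
  exact H.um_of_left (y := t * x) (by rw [mul_assoc, ht])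

theorem um_inv {a x : R} (h : IsUnit (qm a x)) : ∃ t, qm a x * qm a t = 1 ∧ qm a t * qm a x = 1 := by
  obtain ⟨u, hu⟩ := h
  obtain ⟨t, ht⟩ := Ideal.Quotient.mk_surjective (u⁻¹.val)
  exact ⟨t, by rw [qm, ht, ← hu]; simp, by rw [qm, ht, ← hu]; simp⟩

variable [IsDomain R]

theorem BD.wl (H : BD R) {a c r s : R} (hr : IsUnit (qm a r)) (hs : IsUnit (qm c s)) :
    ∃ p r1, IsUnit (qm c p) ∧ IsUnit (qm a r1) ∧ s * r * p - r1 ∈ Ideal.span {c} := by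
  obtain ⟨rh, hr1, hr2⟩ := um_inv hr
  obtain ⟨sh, hs1, hs2⟩ := um_inv hs
  obtain ⟨g11, g12, g21, g22, h11, h12, h21, h22, k, z1, z2, a1, a2, a3, a4, e1, e2, e3, e4⟩ :=
    H.colHermite (rh * (1 - sh * s)) (s * (1 + (1 - sh * s)))
  refine ⟨g12, s * (1 + (1 - sh * s)) * r * g12 - (1 - s * sh) * g22, ?_, ?_, ?_⟩
  · have f1 : h21 * (rh * (1 - sh * s)) + h22 * (s * (1 + (1 - sh * s))) = 0 := by
      rw [z1, z2, ← mul_assoc, ← mul_assoc, ← add_mul, a3, zero_mul]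
    have f2 := congrArg (qm c) f1
    simp only [map_mul, map_add, map_sub, map_one, map_zero, hs2, sub_self, mul_zero, add_zero,
      zero_add, mul_one] at f2
    have f3 : qm c h22 = 0 := by
      rw [← mul_one (qm c h22), ← hs1, ← mul_assoc, f2, zero_mul]
    have f4 := congrArg (qm c) a4
    simp only [map_mul, map_add, map_one, f3, zero_mul, add_zero] at f4
    exact H.um_of_left f4
  · obtain ⟨u, hu⟩ := wl_abstract (H.qL a) (qm a r) (qm a rh) (qm a s) (qm a sh) (qm a g11)
      (qm a g12) (qm a g21) (qm a g22) (qm a h11) (qm a h12) (qm a h21) (qm a h22) (qm a k)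
      hr1 (by simpa using congrArg (qm a) z1) (by simpa using congrArg (qm a) z2)
      (by simpa using congrArg (qm a) e1) (by simpa using congrArg (qm a) e2)
      (by simpa using congrArg (qm a) e3) (by simpa using congrArg (qm a) e4)
    refine H.um_of_right (y := u) ?_
    simpa using hu
  · rw [← qm_eq_zero]
    simp [hs1, hs2]

theorem BD.words (H : BD R) {a c w : R}
    (hw : w ∈ Submonoid.closure {w : R | IsUnit (qm a w) ∨ IsUnit (qm c w)}) :
    ∃ q r1, IsUnit (qm c q) ∧ IsUnit (qm a r1) ∧ w * q - r1 ∈ Ideal.span {c} := by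
  induction hw using Submonoid.closure_induction_left with
  | one => exact ⟨1, 1, by simp, by simp, by simp⟩
  | mul_left x hx y hy ih =>
    obtain ⟨q, r, hq, hr, h⟩ := ih
    rcases hx with hx | hx
    · refine ⟨q, x * r, hq, by rw [map_mul]; exact hx.mul hr, ?_⟩
      have : x * y * q - x * r = x * (y * q - r) := by noncomm_ring
      rw [this]; exact Ideal.mul_mem_left _ _ h
    · obtain ⟨p, r1, hp, hr1, h1⟩ := H.wl hr hx
      refine ⟨q * p, r1, by rw [map_mul]; exact hq.mul hp, hr1, ?_⟩
      have : x * y * (q * p) - r1 = x * (y * q - r) * p + (x * r * p - r1) := by noncomm_ring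
      rw [this]
      exact add_mem (Ideal.mul_mem_right _ _ (Ideal.mul_mem_left _ _ h)) h1

theorem BD.left_div_aux (H : BD R) {a c w : R}
    (hw : w ∈ Submonoid.closure {w : R | IsUnit (qm a w) ∨ IsUnit (qm c w)}) :
    ∀ b t, w ≠ 0 → b * t = w →
      b ∈ Submonoid.closure {w : R | IsUnit (qm a w) ∨ IsUnit (qm c w)} := by
  induction hw using Submonoid.closure_induction_left with
  | one =>
    intro b t _ h
    apply Submonoid.subset_closure
    left
    exact H.um_of_right (y := qm a t) (by rw [← map_mul, h, map_one])
  | mul_left x hx y hy ih =>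
    intro b t h0 h
    obtain ⟨g, b', x', α, β, hb, hxx, hαβ⟩ := H.gcd_coprime b x
    obtain ⟨b2, hb2⟩ := H.hR g b'
    obtain ⟨x2, hx2⟩ := H.hR g x'
    rw [hb2] at hb
    rw [hx2] at hxx
    have hg : g ≠ 0 := by
      rintro rfl
      simp [hxx] at h0
    obtain ⟨α1, hα1⟩ := H.hR g α
    obtain ⟨β1, hβ1⟩ := H.hR g β
    have hc : α1 * b2 + β1 * x2 = 1 := by
      apply mul_left_cancel₀ hg
      calc g * (α1 * b2 + β1 * x2) = (g * α1) * b2 + (g * β1) * x2 := by noncomm_ring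
        _ = α * (g * b2) + β * (g * x2) := by rw [← hα1, ← hβ1]; noncomm_ring
        _ = (α * b' + β * x') * g := by rw [← hb2, ← hx2]; noncomm_ring
        _ = g * 1 := by rw [hαβ]; simp
    have he : b2 * t = x2 * y := by
      apply mul_left_cancel₀ hg
      rw [← mul_assoc, ← mul_assoc, ← hb, ← hxx, h]
    obtain ⟨y1, hy1⟩ := H.hL b2 y
    obtain ⟨t1, ht1⟩ := H.hL b2 t
    have hy2 : y = (α1 * y1 + β1 * t1) * b2 := by
      calc y = (α1 * b2 + β1 * x2) * y := by rw [hc, one_mul]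
        _ = α1 * (b2 * y) + β1 * (x2 * y) := by noncomm_ring
        _ = _ := by rw [← he, hy1, ht1]; noncomm_ring
    obtain ⟨t2, ht2⟩ := H.hR b2 (α1 * y1 + β1 * t1)
    rw [ht2] at hy2
    have := ih b2 t2 (right_ne_zero_of_mul h0) hy2.symm
    rw [hb]
    refine mul_mem (Submonoid.subset_closure ?_) this
    rw [hxx] at hx
    rcases hx with hx | hx
    · left; rw [map_mul] at hx; exact H.um_left hx
    · right; rw [map_mul] at hx; exact H.um_left hx

theorem BD.left_div (H : BD R) {a c b t : R}
    (hw : b * t ∈ Submonoid.closure {w : R | IsUnit (qm a w) ∨ IsUnit (qm c w)}) :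
      b ∈ Submonoid.closure {w : R | IsUnit (qm a w) ∨ IsUnit (qm c w)} := by
  by_cases h0 : b * t = 0
  · rw [h0] at hw
    have key : ∀ w ∈ Submonoid.closure {w : R | IsUnit (qm a w) ∨ IsUnit (qm c w)}, w = 0 →
        (0 : R) ∈ {w : R | IsUnit (qm a w) ∨ IsUnit (qm c w)} := by
      intro w hw
      induction hw using Submonoid.closure_induction_left with
      | one => intro h; exact absurd h one_ne_zero
      | mul_left x hx y hy ih =>
        intro h
        rcases mul_eq_zero.1 h with h | h
        · rw [← h]; exact hx
        · exact ih h
    apply Submonoid.subset_closure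
    rcases key 0 hw rfl with h | h
    · left
      rw [map_zero, isUnit_zero_iff] at h
      exact H.um_of_right (y := 0) (by rw [mul_zero, h])
    · right
      rw [map_zero, isUnit_zero_iff] at h
      exact H.um_of_right (y := 0) (by rw [mul_zero, h])
  · exact H.left_div_aux hw b t h0 rfl

end


section
variable {R : Type*} [Ring R] [∀ I : Ideal R, I.IsTwoSided]

/-- The quotient map to `QuotBy b`. -/
def qb (b : R) : R →+* QuotBy b := (TwoSidedIdeal.span {b}).ringCon.mk'

theorem qb_surj (b : R) : Function.Surjective (qb b) := RingCon.mk'_surjective _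

theorem mem_of_qb_eq {b x y : R} {J : Ideal R} (hb : b ∈ J) (hy : y ∈ J) (h : qb b x = qb b y) :
    x ∈ J := by
  have h1 : (TwoSidedIdeal.span {b}).ringCon x y := (RingCon.eq _).1 h
  rw [TwoSidedIdeal.rel_iff] at h1
  have h2 := TwoSidedIdeal.mem_span_iff.1 h1 (TwoSidedIdeal.mk' (J : Set R) J.zero_mem
    (fun h h' => J.add_mem h h') (fun h => J.neg_mem h) (fun h => J.mul_mem_left _ h)
    (fun h => J.mul_mem_right _ h)) (by
      intro z hz
      rw [Set.mem_singleton_iff] at hz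
      rw [hz, SetLike.mem_coe, TwoSidedIdeal.mem_mk']
      exact hb)
  rw [TwoSidedIdeal.mem_mk'] at h2
  have := J.add_mem h2 hy
  simpa using this

/-- The image of an ideal in `QuotBy b`. -/
def pushI (b : R) (J : Ideal R) : TwoSidedIdeal (QuotBy b) :=
  TwoSidedIdeal.mk' {q | ∃ x ∈ J, qb b x = q} ⟨0, J.zero_mem, map_zero _⟩
    (by rintro _ _ ⟨x, hx, rfl⟩ ⟨y, hy, rfl⟩; exact ⟨x + y, J.add_mem hx hy, map_add _ _ _⟩)
    (by rintro _ ⟨x, hx, rfl⟩; exact ⟨-x, J.neg_mem hx, map_neg _ _⟩)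
    (by
      rintro q _ ⟨x, hx, rfl⟩
      obtain ⟨r, rfl⟩ := qb_surj b q
      exact ⟨r * x, J.mul_mem_left _ hx, map_mul _ _ _⟩)
    (by
      rintro _ q ⟨x, hx, rfl⟩
      obtain ⟨r, rfl⟩ := qb_surj b q
      exact ⟨x * r, J.mul_mem_right _ hx, map_mul _ _ _⟩)

theorem mem_pushI {b : R} {J : Ideal R} (hb : b ∈ J) (x : R) : qb b x ∈ pushI b J ↔ x ∈ J := by
  rw [pushI, TwoSidedIdeal.mem_mk']
  constructor
  · rintro ⟨y, hy, h⟩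
    exact mem_of_qb_eq hb hy h.symm
  · intro h; exact ⟨x, h, rfl⟩

/-- The preimage of an ideal of `QuotBy b`. -/
def pullI (b : R) (K : TwoSidedIdeal (QuotBy b)) : Ideal R where
  carrier := {x | qb b x ∈ K}
  zero_mem' := by simp [K.zero_mem]
  add_mem' := by
    intro x y hx hy
    simp only [Set.mem_setOf_eq, map_add] at *
    exact K.add_mem hx hy
  smul_mem' := by
    intro r x hx
    simp only [Set.mem_setOf_eq, smul_eq_mul, map_mul] at *
    exact K.mul_mem_left _ _ hx

theorem mem_pullI {b : R} {K : TwoSidedIdeal (QuotBy b)} (x : R) : x ∈ pullI b K ↔ qb b x ∈ K :=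
  Iff.rfl

theorem pushI_ne_top {b : R} {J : Ideal R} (hb : b ∈ J) (hJ : J ≠ ⊤) : pushI b J ≠ ⊤ := by
  intro h
  apply hJ
  rw [Ideal.eq_top_iff_one, ← mem_pushI hb, h]
  trivial

theorem pushI_coatom {b : R} {J : Ideal R} (hb : b ∈ J) (hJ : J.IsMaximal) :
    IsCoatom (pushI b J) := by
  refine ⟨pushI_ne_top hb hJ.ne_top, ?_⟩
  intro K hK
  have h1 : J < pullI b K := by
    constructor
    · intro x hx
      rw [mem_pullI]
      exact hK.le ((mem_pushI hb x).2 hx)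
    · intro h
      apply hK.not_ge
      intro q hq
      obtain ⟨r, rfl⟩ := qb_surj b q
      rw [mem_pushI hb]
      exact h hq
  have h2 := hJ.out.2 _ h1
  rw [Ideal.eq_top_iff_one, mem_pullI, map_one] at h2
  rw [eq_top_iff]
  intro x _
  have := K.mul_mem_left x _ h2
  rwa [mul_one] at this

theorem pm_word_aux {a b c : R} (hPM : IsPMRing (QuotBy b))
    (hsum : ∀ M : Ideal R, a ∈ M → b ∈ M → c ∈ M → M = ⊤) :
    ∃ w ∈ Submonoid.closure {w : R | IsUnit (qm a w) ∨ IsUnit (qm c w)}, w ∈ Ideal.span {b} := by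
  set W := Submonoid.closure {w : R | IsUnit (qm a w) ∨ IsUnit (qm c w)} with hW
  by_contra hcon
  push Not at hcon
  obtain ⟨P, hbP, hP⟩ := zorn_le_nonempty₀ {I : Ideal R | ∀ w ∈ W, w ∉ I} (by
    intro C hC hch y hy
    refine ⟨sSup C, ?_, fun z hz => le_sSup hz⟩
    intro w hw hm
    rw [Submodule.mem_sSup_of_directed ⟨y, hy⟩ hch.directedOn] at hm
    obtain ⟨I, hI, hm⟩ := hm
    exact hC hI w hw hm) (Ideal.span {b}) hcon
  have hb : b ∈ P := hbP (Ideal.mem_span_singleton_self b)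
  have hdis : ∀ w ∈ W, w ∉ P := hP.1
  have hPtop : P ≠ ⊤ := by
    intro h
    exact hdis 1 W.one_mem (h ▸ Submodule.mem_top)
  have hext : ∀ x, x ∉ P → ∃ w ∈ W, ∃ p ∈ P, ∃ s, w = p + s * x := by
    intro x hx
    by_contra hno
    push Not at hno
    have : P ⊔ Ideal.span {x} ≤ P := by
      apply hP.2 _ le_sup_left
      intro w hw hm
      obtain ⟨p, hp, z, hz, rfl⟩ := Submodule.mem_sup.1 hm
      obtain ⟨s, rfl⟩ := Ideal.mem_span_singleton'.1 hz
      exact hno _ hw p hp s rfl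
    exact hx (this (Ideal.mem_sup_right (Ideal.mem_span_singleton_self x)))
  have hprime : IsPrimeTwoSided (pushI b P) := by
    refine ⟨pushI_ne_top hb hPtop, ?_⟩
    intro x y hxy
    obtain ⟨x, rfl⟩ := qb_surj b x
    obtain ⟨y, rfl⟩ := qb_surj b y
    rw [mem_pushI hb, mem_pushI hb]
    by_contra hno
    push Not at hno
    obtain ⟨w1, hw1, p1, hp1, s1, e1⟩ := hext x hno.1
    obtain ⟨w2, hw2, p2, hp2, s2, e2⟩ := hext y hno.2
    apply hdis (w1 * w2) (W.mul_mem hw1 hw2)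
    have h3 := hxy (qb b s2)
    rw [← map_mul, ← map_mul, mem_pushI hb] at h3
    have : w1 * w2 = p1 * w2 + s1 * x * p2 + s1 * (x * s2 * y) := by
      rw [e2, e1]; noncomm_ring
    rw [this]
    exact P.add_mem (P.add_mem (P.mul_mem_right _ hp1) (P.mul_mem_left _ hp2))
      (P.mul_mem_left _ h3)
  have hne : ∀ d : R, (∀ x, IsUnit (qm d x) → x ∈ W) → P ⊔ Ideal.span {d} ≠ ⊤ := by
    intro d hd htop
    rw [Ideal.eq_top_iff_one] at htop
    obtain ⟨p, hp, z, hz, h⟩ := Submodule.mem_sup.1 htop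
    refine hdis p (hd p ?_) hp
    have h1 := congrArg (qm d) h
    rw [map_add, qm_eq_zero.2 hz, add_zero, map_one] at h1
    rw [h1]; exact isUnit_one
  obtain ⟨M1, hM1, hM1'⟩ := Ideal.exists_le_maximal _
    (hne a fun x hx => Submonoid.subset_closure (Or.inl hx))
  obtain ⟨M2, hM2, hM2'⟩ := Ideal.exists_le_maximal _
    (hne c fun x hx => Submonoid.subset_closure (Or.inr hx))
  have hb1 : b ∈ M1 := hM1' (Ideal.mem_sup_left hb)
  have hb2 : b ∈ M2 := hM2' (Ideal.mem_sup_left hb)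
  have ha1 : a ∈ M1 := hM1' (Ideal.mem_sup_right (Ideal.mem_span_singleton_self a))
  have hc2 : c ∈ M2 := hM2' (Ideal.mem_sup_right (Ideal.mem_span_singleton_self c))
  have hle : ∀ M : Ideal R, b ∈ M → P ≤ M → pushI b P ≤ pushI b M := by
    intro M hbM hPM q hq
    obtain ⟨r, rfl⟩ := qb_surj b q
    rw [mem_pushI hb] at hq
    rw [mem_pushI hbM]
    exact hPM hq
  have heq := (hPM _ hprime).unique
    ⟨pushI_coatom hb1 hM1, hle M1 hb1 (le_sup_left.trans hM1')⟩
    ⟨pushI_coatom hb2 hM2, hle M2 hb2 (le_sup_left.trans hM2')⟩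
  have hc1 : c ∈ M1 := by
    rw [← mem_pushI hb1, heq, mem_pushI hb2]; exact hc2
  exact hM1.ne_top (hsum M1 ha1 hb1 hc1)

variable [IsDomain R]

theorem BD.pm_word (H : BD R) {a b c : R} (hPM : IsPMRing (QuotBy b))
    (hsum : ∀ M : Ideal R, a ∈ M → b ∈ M → c ∈ M → M = ⊤) :
    b ∈ Submonoid.closure {w : R | IsUnit (qm a w) ∨ IsUnit (qm c w)} := by
  obtain ⟨w, hw, hb⟩ := pm_word_aux hPM hsum
  obtain ⟨t, rfl⟩ := Ideal.mem_span_singleton'.1 hb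
  obtain ⟨t', ht'⟩ := H.hR b t
  rw [ht'] at hw
  exact H.left_div hw

end


section
variable {R : Type*} [Ring R] [IsDomain R] [∀ I : Ideal R, I.IsTwoSided]

theorem BD.two (H : BD R)
    (hG : ∀ a b : R, (∃ x y : R, a * x + b * y = 1) → ∃ y : R, IsPMRing (QuotBy (a + b * y)))
    (a b c s t u : R) (h : s * a + t * b + u * c = 1) :
    ∃ x0 x1 y0 y1 : R, x0 * (a * y0 + b * y1) + x1 * c * y1 = 1 := by
  obtain ⟨d, a', c', α, β, ha, hc, hd⟩ := H.gcd a c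
  obtain ⟨t', ht'⟩ := H.hR b t
  obtain ⟨v', hv'⟩ := H.hR d (s * a' + u * c')
  obtain ⟨y, hPM⟩ := hG b d ⟨t', v', by
    rw [← ht', ← hv', ← h]
    rw [ha, hc]
    noncomm_ring⟩
  have hW := H.pm_word (a := a) (c := c) hPM (by
    intro M h1 h2 h3
    have hdM : d ∈ M := by
      rw [← hd]; exact M.add_mem (M.mul_mem_left _ h1) (M.mul_mem_left _ h3)
    have hbM : b ∈ M := by
      have := M.sub_mem h2 (M.mul_mem_right y hdM)
      simpa using this
    rw [Ideal.eq_top_iff_one, ← h]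
    exact M.add_mem (M.add_mem (M.mul_mem_left _ h1) (M.mul_mem_left _ hbM)) (M.mul_mem_left _ h3))
  obtain ⟨q, r1, hq, hr1, hm⟩ := H.words hW
  obtain ⟨v, hv⟩ := Ideal.mem_span_singleton'.1 hm
  obtain ⟨x, Y, hxY⟩ : ∃ x Y, b * q + a * x + Y * c = r1 := by
    obtain ⟨x, hx⟩ := H.hR a α
    obtain ⟨z, hz⟩ := H.hL c (y * q)
    refine ⟨x * (y * q), β * z - v, ?_⟩
    calc b * q + a * (x * (y * q)) + (β * z - v) * c
        = b * q + (a * x) * (y * q) + β * (z * c) - v * c := by noncomm_ring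
      _ = b * q + (α * a + β * c) * (y * q) - v * c := by rw [← hx, ← hz]; noncomm_ring
      _ = r1 := by rw [hd, hv]; noncomm_ring
  obtain ⟨qs, hqs, hqs'⟩ : ∃ qs, c * q = qs * c ∧ IsUnit (qm c qs) := by
    by_cases hc0 : c = 0
    · exact ⟨q, by simp [hc0], hq⟩
    · obtain ⟨qs, hqs⟩ := H.hL c q
      refine ⟨qs, hqs, ?_⟩
      obtain ⟨t, ht, -⟩ := um_inv hq
      rw [← map_mul, ← sub_eq_zero, ← map_one (qm c), ← map_sub, qm_eq_zero] at ht
      obtain ⟨v, hv⟩ := Ideal.mem_span_singleton'.1 ht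
      obtain ⟨ts, hts⟩ := H.hL c t
      have h1 : qs * ts - 1 = c * v := by
        apply mul_right_cancel₀ hc0
        calc (qs * ts - 1) * c = qs * (ts * c) - c := by noncomm_ring
          _ = (qs * c) * t - c := by rw [← hts]; noncomm_ring
          _ = c * (q * t - 1) := by rw [← hqs]; noncomm_ring
          _ = c * v * c := by rw [← hv]; noncomm_ring
      refine H.um_of_right (y := qm c ts) ?_
      rw [← map_mul, ← sub_eq_zero, ← map_one (qm c), ← map_sub, qm_eq_zero, h1]
      exact Ideal.mul_mem_right _ _ (Ideal.mem_span_singleton_self c)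
  obtain ⟨g11, g12, g21, g22, h11, h12, x0, x1, k, z1, z2, -, -, a3, a4, -⟩ :=
    H.colHermite (-Y) qs
  have hx : x0 * (-Y) + x1 * qs = 0 := by
    rw [z1, z2, ← mul_assoc, ← mul_assoc, ← add_mul, a3, zero_mul]
  set J : Ideal R := Ideal.span {x0 * a, x0 * b + x1 * c} with hJ
  have hj1 : x0 * a ∈ J := Ideal.subset_span (by simp)
  have hj2 : x0 * b + x1 * c ∈ J := Ideal.subset_span (by simp)
  have hj3 : x0 * r1 ∈ J := by
    have : x0 * r1 = (x0 * b + x1 * c) * q + x0 * a * x := by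
      calc x0 * r1 = x0 * (b * q + a * x + Y * c) := by rw [hxY]
        _ = x0 * b * q + x0 * a * x + x1 * (qs * c) - (x0 * (-Y) + x1 * qs) * c := by noncomm_ring
        _ = _ := by rw [hx, ← hqs]; noncomm_ring
    rw [this]
    exact J.add_mem (J.mul_mem_right _ hj2) (J.mul_mem_right _ hj1)
  have cop : ∀ e z z' : R, IsUnit (qm e z) → z' * z ∈ J → z' * e ∈ J → z' ∈ J := by
    intro e z z' hu h1 h2
    obtain ⟨t, ht, -⟩ := um_inv hu
    rw [← map_mul, ← sub_eq_zero, ← map_one (qm e), ← map_sub, qm_eq_zero] at ht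
    obtain ⟨v, hv⟩ := Ideal.mem_span_singleton'.1 ht
    obtain ⟨v', hv'⟩ := H.hR e v
    have : z' = z' * z * t - z' * e * v' := by
      calc z' = z' * (z * t) - z' * (z * t - 1) := by noncomm_ring
        _ = _ := by rw [← hv, hv']; noncomm_ring
    rw [this]
    exact J.sub_mem (J.mul_mem_right _ h1) (J.mul_mem_right _ h2)
  have hx0 : x0 ∈ J := cop a r1 x0 hr1 hj3 hj1
  have hx1 : x1 ∈ J := by
    refine cop c qs x1 hqs' ?_ ?_
    · have : x1 * qs = x0 * Y := by
        rw [mul_neg, add_comm, ← sub_eq_add_neg, sub_eq_zero] at hx; exact hx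
      rw [this]; exact J.mul_mem_right _ hx0
    · have := J.sub_mem hj2 (J.mul_mem_right b hx0)
      simpa using this
  have h1 : (1 : R) ∈ J := by
    rw [← a4]; exact J.add_mem (J.mul_mem_right _ hx0) (J.mul_mem_right _ hx1)
  obtain ⟨l0, l1, hl⟩ := Ideal.mem_span_pair.1 h1
  obtain ⟨y0, hy0⟩ := H.hR (x0 * a) l0
  obtain ⟨y1, hy1⟩ := H.hR (x0 * b + x1 * c) l1
  refine ⟨x0, x1, y0, y1, ?_⟩
  rw [← hl, hy0, hy1]
  noncomm_ring

theorem BD.two' (H : BD R)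
    (hG : ∀ a b : R, (∃ x y : R, a * x + b * y = 1) → ∃ y : R, IsPMRing (QuotBy (a + b * y)))
    (a b c : R) :
    ∃ x0 x1 y0 y1 g a' b' c' : R, x0 * (a * y0 + b * y1) + x1 * c * y1 = g ∧
      a = g * a' ∧ b = g * b' ∧ c = g * c' := by
  obtain ⟨g1, a1, b1, α, β, ha, hb, hg1⟩ := H.gcd a b
  obtain ⟨g, f1, c1, γ, δ, hf, hc, hg⟩ := H.gcd g1 c
  obtain ⟨a', ha'⟩ := H.hR g (a1 * f1)
  obtain ⟨b', hb'⟩ := H.hR g (b1 * f1)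
  obtain ⟨c', hc'⟩ := H.hR g c1
  rw [← hc] at hc'
  rw [mul_assoc, ← hf, ← ha] at ha'
  rw [mul_assoc, ← hf, ← hb] at hb'
  by_cases hg0 : g = 0
  · refine ⟨0, 0, 0, 0, 0, 0, 0, 0, ?_, ?_, ?_, ?_⟩ <;> simp [ha', hb', hc', hg0]
  · obtain ⟨s, hs⟩ := H.hR g (γ * α)
    obtain ⟨t, ht⟩ := H.hR g (γ * β)
    obtain ⟨u, hu⟩ := H.hR g δ
    obtain ⟨x0, x1, y0, y1, h⟩ := H.two hG a' b' c' s t u (by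
      apply mul_left_cancel₀ hg0
      calc g * (s * a' + t * b' + u * c') = (g * s) * a' + (g * t) * b' + (g * u) * c' := by
            noncomm_ring
        _ = γ * (α * (g * a') + β * (g * b')) + δ * (g * c') := by
            rw [← hs, ← ht, ← hu]; noncomm_ring
        _ = g * 1 := by rw [← ha', ← hb', ← hc', hg1, hg, mul_one])
    obtain ⟨X0, hX0⟩ := H.hL g x0
    obtain ⟨X1, hX1⟩ := H.hL g x1
    refine ⟨X0, X1, y0, y1, g, a', b', c', ?_, ha', hb', hc'⟩
    rw [ha', hb', hc']
    calc _ = (X0 * g) * (a' * y0 + b' * y1) + (X1 * g) * c' * y1 := by noncomm_ring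
      _ = g * (x0 * (a' * y0 + b' * y1) + x1 * c' * y1) := by
        rw [← hX0, ← hX1]; noncomm_ring
      _ = g := by rw [h, mul_one]

end


section
variable {R : Type*} [Ring R] [IsDomain R]

theorem BD.gcdR (H : BD R) (x y : R) : ∃ g x' y' α β : R, x = g * x' ∧ y = g * y' ∧
    x * α + y * β = g := by
  obtain ⟨g, x', y', α, β, hx, hy, h⟩ := H.gcd x y
  obtain ⟨x'', hx'⟩ := H.hR g x'
  obtain ⟨y'', hy'⟩ := H.hR g y'
  obtain ⟨α', hα⟩ := H.hR x α
  obtain ⟨β', hβ⟩ := H.hR y β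
  exact ⟨g, x'', y'', α', β', by rw [← hx', hx], by rw [← hy', hy], by rw [← hα, ← hβ, h]⟩

theorem BD.gcdFin (H : BD R) : ∀ (n : ℕ) (f : Fin n → R), ∃ (γ : R) (t f' : Fin n → R),
    ∑ j, f j * t j = γ ∧ ∀ j, f j = γ * f' j := by
  intro n
  induction n with
  | zero => intro f; exact ⟨0, f, f, by simp, fun j => j.elim0⟩
  | succ n ih =>
    intro f
    obtain ⟨γ, t, f', h1, h2⟩ := ih (fun j => f j.succ)
    obtain ⟨g, x', y', α, β, hx, hy, h⟩ := H.gcdR (f 0) γ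
    refine ⟨g, Fin.cons α (fun j => t j * β), Fin.cons x' (fun j => y' * f' j), ?_, ?_⟩
    · rw [Fin.sum_univ_succ]
      simp only [Fin.cons_zero, Fin.cons_succ, ← mul_assoc]
      rw [← Finset.sum_mul, h1, h]
    · intro j
      refine Fin.cases ?_ (fun j => ?_) j
      · simpa using hx
      · simp only [Fin.cons_succ]
        rw [h2 j, hy, mul_assoc]

variable [∀ I : Ideal R, I.IsTwoSided]

theorem BD.general (H : BD R)
    (hG : ∀ a b : R, (∃ x y : R, a * x + b * y = 1) → ∃ y : R, IsPMRing (QuotBy (a + b * y)))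
    (n : ℕ) : ∀ (m : ℕ) (A : Fin m → Fin n → R),
    ∃ (δ : R) (x : Fin m → R) (y : Fin n → R) (A0 : Fin m → Fin n → R),
      ∑ i, x i * ∑ j, A i j * y j = δ ∧ ∀ i j, A i j = δ * A0 i j := by
  intro m
  induction m with
  | zero => intro A; exact ⟨0, fun _ => 0, fun _ => 0, A, by simp, fun i => i.elim0⟩
  | succ m ih =>
    intro A
    obtain ⟨δ, x, y, B0, h1, h2⟩ := ih (fun i => A i.succ)
    choose x' hx' using fun i => H.hR δ (x i)
    set β : Fin n → R := fun j => ∑ i, x' i * B0 i j with hβ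
    have hβ' : ∀ j, ∑ i, x i * A i.succ j = δ * β j := by
      intro j
      rw [hβ, Finset.mul_sum]
      refine Finset.sum_congr rfl fun i _ => ?_
      rw [h2, ← mul_assoc, hx', mul_assoc]
    set v0 := ∑ j, A 0 j * y j with hv0
    obtain ⟨γ, t, γ', hγ, hγ'⟩ := H.gcdFin n (fun j => A 0 j - v0 * β j)
    set τ := ∑ j, β j * t j with hτ
    set y2 : Fin n → R := fun j => t j - y j * τ with hy2
    have k1 : ∑ j, A 0 j * y2 j = γ := by
      rw [← hγ, hy2]
      simp only [mul_sub, sub_mul, Finset.sum_sub_distrib, ← mul_assoc]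
      rw [← Finset.sum_mul, ← hv0, hτ, Finset.mul_sum]
      simp only [mul_assoc]
    have k2 : ∑ i, x i * ∑ j, A i.succ j * y2 j = 0 := by
      have : ∀ i, x i * ∑ j, A i.succ j * y2 j
          = ∑ j, x i * A i.succ j * t j - (x i * ∑ j, A i.succ j * y j) * τ := by
        intro i
        simp only [hy2, mul_sub, Finset.sum_sub_distrib, ← mul_assoc, Finset.mul_sum,
          Finset.sum_mul]
      simp only [this]
      rw [Finset.sum_sub_distrib, ← Finset.sum_mul, h1, Finset.sum_comm, sub_eq_zero, hτ,
        Finset.mul_sum]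
      refine Finset.sum_congr rfl fun j _ => ?_
      rw [← Finset.sum_mul, hβ', mul_assoc]
    obtain ⟨X0, X1, Y0, Y1, g, c1, c2, c3, hg, d1, d2, d3⟩ := H.two' hG γ v0 δ
    have k3 : ∀ w : Fin n → R, ∑ j, w j * (y2 j * Y0 + y j * Y1)
        = (∑ j, w j * y2 j) * Y0 + (∑ j, w j * y j) * Y1 := by
      intro w
      simp only [mul_add, Finset.sum_add_distrib, ← mul_assoc, Finset.sum_mul]
    refine ⟨g, Fin.cons X0 (fun i => X1 * x i), fun j => y2 j * Y0 + y j * Y1,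
      Fin.cons (fun j => c1 * γ' j + c2 * β j) (fun i j => c3 * B0 i j), ?_, ?_⟩
    · rw [Fin.sum_univ_succ]
      simp only [Fin.cons_zero, Fin.cons_succ, k3]
      rw [k1, ← hv0]
      have : ∑ i, X1 * x i * ((∑ j, A i.succ j * y2 j) * Y0 + (∑ j, A i.succ j * y j) * Y1)
          = X1 * (∑ i, x i * ∑ j, A i.succ j * y2 j) * Y0
            + X1 * (∑ i, x i * ∑ j, A i.succ j * y j) * Y1 := by
        rw [Finset.mul_sum, Finset.mul_sum, Finset.sum_mul, Finset.sum_mul,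
          ← Finset.sum_add_distrib]
        refine Finset.sum_congr rfl fun i _ => ?_
        noncomm_ring
      rw [this, k2, h1, mul_zero, zero_mul, zero_add, hg]
    · intro i j
      refine Fin.cases ?_ (fun i => ?_) i
      · simp only [Fin.cons_zero]
        have := hγ' j
        rw [sub_eq_iff_eq_add] at this
        rw [this, mul_add, ← mul_assoc, ← d1, ← mul_assoc, ← d2]
      · simp only [Fin.cons_succ]
        rw [h2, ← mul_assoc, ← d3]

end


open Matrix in
/-- Block-diagonal matrix with a `1 × 1` block `d` and a block `B`. -/
def blk {R : Type*} [Ring R] {m n : ℕ} (d : R) (B : Matrix (Fin m) (Fin n) R) :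
    Matrix (Fin (m + 1)) (Fin (n + 1)) R :=
  Matrix.of (Fin.cons (Fin.cons d (fun _ => 0)) (fun i => Fin.cons 0 (B i)))

section blk
variable {R : Type*} [Ring R] {m n : ℕ}

@[simp] theorem blk_00 (d : R) (B : Matrix (Fin m) (Fin n) R) : blk d B 0 0 = d := rfl
@[simp] theorem blk_0s (d : R) (B : Matrix (Fin m) (Fin n) R) (j) : blk d B 0 (Fin.succ j) = 0 := rfl
@[simp] theorem blk_s0 (d : R) (B : Matrix (Fin m) (Fin n) R) (i) : blk d B (Fin.succ i) 0 = 0 := rfl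
@[simp] theorem blk_ss (d : R) (B : Matrix (Fin m) (Fin n) R) (i j) :
    blk d B (Fin.succ i) (Fin.succ j) = B i j := rfl

theorem blk_mul {l : ℕ} (d e : R) (B : Matrix (Fin m) (Fin n) R) (C : Matrix (Fin n) (Fin l) R) :
    blk d B * blk e C = blk (d * e) (B * C) := by
  ext i j
  rw [Matrix.mul_apply, Fin.sum_univ_succ]
  refine Fin.cases ?_ (fun i => ?_) i <;> refine Fin.cases ?_ (fun j => ?_) j <;>
    simp [Matrix.mul_apply]

theorem blk_one : blk (1 : R) (1 : Matrix (Fin n) (Fin n) R) = 1 := by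
  ext i j
  refine Fin.cases ?_ (fun i => ?_) i <;> refine Fin.cases ?_ (fun j => ?_) j <;>
    simp [Matrix.one_apply, Fin.succ_ne_zero, (Fin.succ_ne_zero _).symm]

/-- Identity matrix with the first row replaced by `(s, r)`. -/
def upm (s : R) (r : Fin n → R) : Matrix (Fin (n + 1)) (Fin (n + 1)) R :=
  Matrix.of (Fin.cons (Fin.cons s r) (fun i => Fin.cons 0 ((1 : Matrix (Fin n) (Fin n) R) i)))

@[simp] theorem upm_00 (s : R) (r : Fin n → R) : upm s r 0 0 = s := rfl
@[simp] theorem upm_0s (s : R) (r : Fin n → R) (j) : upm s r 0 (Fin.succ j) = r j := rfl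
@[simp] theorem upm_s0 (s : R) (r : Fin n → R) (i) : upm s r (Fin.succ i) 0 = 0 := rfl
@[simp] theorem upm_ss (s : R) (r : Fin n → R) (i j) :
    upm s r (Fin.succ i) (Fin.succ j) = (1 : Matrix (Fin n) (Fin n) R) i j := rfl

theorem upm_mul (s s' : R) (r r' : Fin n → R) :
    upm s r * upm s' r' = upm (s * s') (fun j => s * r' j + r j) := by
  ext i j
  rw [Matrix.mul_apply, Fin.sum_univ_succ]
  refine Fin.cases ?_ (fun i => ?_) i <;> refine Fin.cases ?_ (fun j => ?_) j <;>
    simp [Matrix.one_apply]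

theorem upm_one : upm (1 : R) (fun _ : Fin n => 0) = 1 := by
  ext i j
  refine Fin.cases ?_ (fun i => ?_) i <;> refine Fin.cases ?_ (fun j => ?_) j <;>
    simp [Matrix.one_apply, Fin.succ_ne_zero, (Fin.succ_ne_zero _).symm]

/-- Identity matrix with the upper left `2 × 2` block replaced. -/
def tl (a b c d : R) : Matrix (Fin (n + 2)) (Fin (n + 2)) R :=
  Matrix.of (Fin.cons (Fin.cons a (Fin.cons b (fun _ => 0)))
    (Fin.cons (Fin.cons c (Fin.cons d (fun _ => 0)))
      (fun i => Fin.cons 0 (Fin.cons 0 ((1 : Matrix (Fin n) (Fin n) R) i)))))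

theorem tl_apply (a b c d : R) (i j : Fin (n + 2)) : (tl a b c d : Matrix _ _ R) i j =
  (Fin.cons (Fin.cons a (Fin.cons b (fun _ => 0)))
    (Fin.cons (Fin.cons c (Fin.cons d (fun _ => 0)))
      (fun i => Fin.cons 0 (Fin.cons 0 ((1 : Matrix (Fin n) (Fin n) R) i)))) :
        Fin (n + 2) → Fin (n + 2) → R) i j := rfl

theorem tl_mul (a b c d a' b' c' d' : R) :
    (tl a b c d : Matrix (Fin (n + 2)) (Fin (n + 2)) R) * tl a' b' c' d' =
      tl (a * a' + b * c') (a * b' + b * d') (c * a' + d * c') (c * b' + d * d') := by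
  ext i j
  rw [Matrix.mul_apply, Fin.sum_univ_succ, Fin.sum_univ_succ]
  refine Fin.cases ?_ (fun i => ?_) i
  · refine Fin.cases ?_ (fun j => ?_) j
    · simp [tl_apply]
    · refine Fin.cases ?_ (fun j => ?_) j <;> simp [tl_apply]
  · refine Fin.cases ?_ (fun i => ?_) i
    · refine Fin.cases ?_ (fun j => ?_) j
      · simp [tl_apply]
      · refine Fin.cases ?_ (fun j => ?_) j <;> simp [tl_apply]
    · refine Fin.cases ?_ (fun j => ?_) j
      · simp [tl_apply]
      · refine Fin.cases ?_ (fun j => ?_) j <;> simp [tl_apply, Matrix.one_apply]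

theorem tl_one : (tl 1 0 0 1 : Matrix (Fin (n + 2)) (Fin (n + 2)) R) = 1 := by
  ext i j
  refine Fin.cases ?_ (fun i => ?_) i
  · refine Fin.cases ?_ (fun j => ?_) j
    · simp [tl_apply]
    · refine Fin.cases ?_ (fun j => ?_) j <;> simp [tl_apply, Matrix.one_apply, Fin.ext_iff]
  · refine Fin.cases ?_ (fun i => ?_) i
    · refine Fin.cases ?_ (fun j => ?_) j
      · simp [tl_apply, Matrix.one_apply, Fin.ext_iff]
      · refine Fin.cases ?_ (fun j => ?_) j <;> simp [tl_apply, Matrix.one_apply, Fin.ext_iff]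
    · refine Fin.cases ?_ (fun j => ?_) j
      · simp [tl_apply, Matrix.one_apply, Fin.ext_iff]
      · refine Fin.cases ?_ (fun j => ?_) j <;> simp [tl_apply, Matrix.one_apply, Fin.ext_iff]

end blk

section
variable {R : Type*} [Ring R] [IsDomain R]

open Matrix in
theorem BD.colHermiteN (H : BD R) : ∀ (n : ℕ) (v : Fin (n + 1) → R),
    ∃ P Pi : Matrix (Fin (n + 1)) (Fin (n + 1)) R, P * Pi = 1 ∧ Pi * P = 1 ∧
      ∀ i : Fin n, (P *ᵥ v) i.succ = 0 := by
  intro n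
  induction n with
  | zero => intro v; exact ⟨1, 1, by simp, by simp, fun i => i.elim0⟩
  | succ n ih =>
    intro v
    obtain ⟨P, Pi, h1, h2, h3⟩ := ih (fun i => v i.succ)
    obtain ⟨g11, g12, g21, g22, h11, h12, h21, h22, k, z1, z2, a1, a2, a3, a4, e1, e2, e3, e4⟩ :=
      H.colHermite (v 0) ((P *ᵥ (fun i => v i.succ)) 0)
    refine ⟨tl h11 h12 h21 h22 * blk 1 P, blk 1 Pi * tl g11 g12 g21 g22, ?_, ?_, ?_⟩
    · rw [Matrix.mul_assoc, ← Matrix.mul_assoc (blk 1 P), blk_mul, h1, mul_one, blk_one,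
        Matrix.one_mul, tl_mul, a1, a2, a3, a4, tl_one]
    · rw [Matrix.mul_assoc, ← Matrix.mul_assoc (tl _ _ _ _), tl_mul, e1, e2, e3, e4, tl_one,
        Matrix.one_mul, blk_mul, h2, mul_one, blk_one]
    · have w0 : (blk 1 P *ᵥ v) 0 = v 0 := by
        simp [Matrix.mulVec, dotProduct, Fin.sum_univ_succ (n := n + 1)]
      have ws : ∀ i, (blk 1 P *ᵥ v) (Fin.succ i) = (P *ᵥ (fun i => v i.succ)) i := by
        intro i
        simp [Matrix.mulVec, dotProduct, Fin.sum_univ_succ (n := n + 1)]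
      intro i
      rw [← Matrix.mulVec_mulVec]
      generalize hw : blk 1 P *ᵥ v = w at *
      rw [Matrix.mulVec, dotProduct, Fin.sum_univ_succ, Fin.sum_univ_succ]
      have w2 : ∀ j : Fin n, w j.succ.succ = 0 := fun j => by rw [ws, h3]
      have w1 := ws 0
      simp only [w2, mul_zero, Finset.sum_const_zero, add_zero]
      rw [w0, w1]
      refine Fin.cases ?_ (fun i => ?_) i
      · have : h21 * v 0 + h22 * (P *ᵥ (fun i => v i.succ)) 0 = 0 := by
          rw [z1, z2, ← mul_assoc, ← mul_assoc, ← add_mul, a3, zero_mul]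
        simpa [tl_apply] using this
      · simp [tl_apply]

open Matrix in
theorem BD.step (H : BD R) {m n : ℕ} (A : Matrix (Fin (m + 1)) (Fin (n + 1)) R)
    (x : Fin (m + 1) → R) (y : Fin (n + 1) → R) (h : x ⬝ᵥ (A *ᵥ y) = 1) :
    ∃ (P : Matrix (Fin (m + 1)) (Fin (m + 1)) R) (Q : Matrix (Fin (n + 1)) (Fin (n + 1)) R)
      (B : Matrix (Fin m) (Fin n) R), IsUnit P ∧ IsUnit Q ∧ P * A * Q = blk 1 B := by
  obtain ⟨P, Pi, h1, h2, h3⟩ := H.colHermiteN n y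
  set w : Fin (m + 1) → R := fun i => (A * Pi) i 0 with hw
  have hw1 : ∀ i, (A *ᵥ y) i = w i * (P *ᵥ y) 0 := by
    intro i
    have : A *ᵥ y = (A * Pi) *ᵥ (P *ᵥ y) := by
      rw [Matrix.mulVec_mulVec, Matrix.mul_assoc, h2, Matrix.mul_one]
    rw [this, Matrix.mulVec, dotProduct, Fin.sum_univ_succ]
    simp [h3, hw]
  obtain ⟨S, Si, k1, k2, k3⟩ := H.colHermiteN m w
  have hA : ∀ i, (S * (A * Pi)) i 0 = (S *ᵥ w) i := by
    intro i; rw [Matrix.mul_apply]; rfl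
  set g2 := (S *ᵥ w) 0 with hg2
  have e1 : (x ᵥ* Si) 0 * g2 * (P *ᵥ y) 0 = 1 := by
    have e2 : x ⬝ᵥ w = (x ᵥ* Si) 0 * g2 := by
      have : x ⬝ᵥ w = (x ᵥ* Si) ⬝ᵥ (S *ᵥ w) := by
        rw [← Matrix.dotProduct_mulVec, Matrix.mulVec_mulVec, k2, Matrix.one_mulVec]
      rw [this, dotProduct, Fin.sum_univ_succ]
      simp [k3, hg2]
    rw [← e2, ← h, dotProduct, dotProduct, Finset.sum_mul]
    simp only [hw1, mul_assoc]
  obtain ⟨g3, hg3, hg3'⟩ : ∃ g3, g2 * g3 = 1 ∧ g3 * g2 = 1 := by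
    rw [mul_assoc] at e1
    have e2 := mul_eq_one_symm e1
    rw [mul_assoc] at e2
    exact ⟨_, e2, mul_eq_one_symm e2⟩
  set A2 := S * (A * Pi) with hA2
  set a : Fin n → R := fun j => A2 0 j.succ with ha
  refine ⟨S, Pi * upm g3 (fun j => -(g3 * a j)), Matrix.of fun i j => A2 i.succ j.succ, ?_, ?_, ?_⟩
  · exact isUnit_iff_exists.2 ⟨Si, k1, k2⟩
  · refine IsUnit.mul (isUnit_iff_exists.2 ⟨P, h2, h1⟩) (isUnit_iff_exists.2 ⟨upm g2 a, ?_, ?_⟩)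
    · rw [upm_mul, hg3']
      simp [upm_one]
    · rw [upm_mul, hg3]
      simp [← mul_assoc, hg3, upm_one]
  · rw [Matrix.mul_assoc S, ← Matrix.mul_assoc A, ← Matrix.mul_assoc S, ← hA2]
    ext i j
    rw [Matrix.mul_apply, Fin.sum_univ_succ]
    refine Fin.cases ?_ (fun i => ?_) i <;> refine Fin.cases ?_ (fun j => ?_) j
    · simp [hA, ← hg2, hg3]
    · simp [hA, ← hg2, ← mul_assoc, hg3, Matrix.one_apply, ha]
    · simp [hA, k3]
    · simp [hA, k3, Matrix.one_apply]

/-- Diagonal reduction with one-sided divisibility. -/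
def Adm' {m n : ℕ} (A : Matrix (Fin m) (Fin n) R) : Prop :=
  ∃ (P : Matrix (Fin m) (Fin m) R) (Q : Matrix (Fin n) (Fin n) R),
    IsUnit P ∧ IsUnit Q ∧
    (∀ (i : Fin m) (j : Fin n), (i : ℕ) ≠ (j : ℕ) → (P * A * Q) i j = 0) ∧
    (∀ (i : Fin m) (j : Fin n) (i' : Fin m) (j' : Fin n),
      (i : ℕ) = (j : ℕ) → (i' : ℕ) = (j' : ℕ) → (i' : ℕ) = (i : ℕ) + 1 →
      ∃ u : R, (P * A * Q) i' j' = (P * A * Q) i j * u)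

theorem BD.adm (H : BD R) {m n : ℕ} {A : Matrix (Fin m) (Fin n) R} (h : Adm' A) :
    AdmitsDiagonalReduction A := by
  obtain ⟨P, Q, hP, hQ, h1, h2⟩ := h
  refine ⟨P, Q, hP, hQ, h1, ?_⟩
  intro i j i' j' e1 e2 e3 x y
  obtain ⟨u, hu⟩ := h2 i j i' j' e1 e2 e3
  obtain ⟨x', hx'⟩ := H.hR ((P * A * Q) i j) x
  obtain ⟨v, hv⟩ := H.hL ((P * A * Q) i j) (x' * u * y)
  have : x * (P * A * Q) i' j' * y = (P * A * Q) i j * (x' * u * y) := by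
    rw [hu, ← mul_assoc, hx']; simp only [mul_assoc]
  exact ⟨⟨_, this⟩, ⟨v, by rw [this, hv]⟩⟩

theorem BD.exists_conj (H : BD R) {δ : R} (hδ : δ ≠ 0) :
    ∃ φ : R →+* R, ∀ x, φ x * δ = δ * x := by
  choose f hf using H.hL δ
  refine ⟨{ toFun := f, map_one' := ?_, map_mul' := ?_, map_zero' := ?_, map_add' := ?_ },
    fun x => (hf x).symm⟩
  · apply mul_right_cancel₀ hδ; rw [← hf]; simp
  · intro x y
    apply mul_right_cancel₀ hδ
    rw [← hf, mul_assoc, ← hf, ← mul_assoc, hf, mul_assoc]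
  · apply mul_right_cancel₀ hδ; rw [← hf]; simp
  · intro x y
    apply mul_right_cancel₀ hδ
    rw [← hf, add_mul, ← hf, ← hf, mul_add]

theorem BD.adm_scale (H : BD R) {m n : ℕ} {A A0 : Matrix (Fin m) (Fin n) R} {δ : R} (hδ : δ ≠ 0)
    (hA : ∀ i j, A i j = δ * A0 i j) (h : Adm' A0) : Adm' A := by
  obtain ⟨P, Q, hP, hQ, h1, h2⟩ := h
  obtain ⟨φ, hφ⟩ := H.exists_conj hδ
  have key : ∀ i j, (φ.mapMatrix P * A * Q) i j = δ * (P * A0 * Q) i j := by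
    intro i j
    simp only [Matrix.mul_apply, Finset.mul_sum, Finset.sum_mul]
    refine Finset.sum_congr rfl fun k _ => Finset.sum_congr rfl fun l _ => ?_
    rw [hA, RingHom.mapMatrix_apply, Matrix.map_apply, ← mul_assoc (φ _), hφ]
    simp only [mul_assoc]
  refine ⟨φ.mapMatrix P, Q, hP.map _, hQ, ?_, ?_⟩
  · intro i j hij
    rw [key, h1 i j hij, mul_zero]
  · intro i j i' j' e1 e2 e3
    obtain ⟨u, hu⟩ := h2 i j i' j' e1 e2 e3
    exact ⟨u, by rw [key, key, hu, mul_assoc]⟩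

theorem adm_blk {m n : ℕ} {A : Matrix (Fin (m + 1)) (Fin (n + 1)) R} {B : Matrix (Fin m) (Fin n) R}
    {P : Matrix (Fin (m + 1)) (Fin (m + 1)) R} {Q : Matrix (Fin (n + 1)) (Fin (n + 1)) R}
    (hP : IsUnit P) (hQ : IsUnit Q) (hAB : P * A * Q = blk 1 B) (h : Adm' B) : Adm' A := by
  obtain ⟨P1, Q1, hP1, hQ1, h1, h2⟩ := h
  have hu : ∀ {n : ℕ} {M : Matrix (Fin n) (Fin n) R}, IsUnit M → IsUnit (blk 1 M) := by
    intro n M hM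
    obtain ⟨N, hN, hN'⟩ := isUnit_iff_exists.1 hM
    exact isUnit_iff_exists.2 ⟨blk 1 N, by rw [blk_mul, hN, mul_one, blk_one],
      by rw [blk_mul, hN', mul_one, blk_one]⟩
  have key : blk 1 P1 * P * A * (Q * blk 1 Q1) = blk 1 (P1 * B * Q1) := by
    have : blk 1 P1 * P * A * (Q * blk 1 Q1) = blk 1 P1 * (P * A * Q) * blk 1 Q1 := by
      simp only [Matrix.mul_assoc]
    rw [this, hAB, blk_mul, blk_mul]; simp
  refine ⟨blk 1 P1 * P, Q * blk 1 Q1, (hu hP1).mul hP, hQ.mul (hu hQ1), ?_, ?_⟩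
  · rw [key]
    intro i j
    refine Fin.cases ?_ (fun i => ?_) i <;> refine Fin.cases ?_ (fun j => ?_) j
    · simp
    · simp
    · simp
    · intro hij
      rw [blk_ss]
      apply h1
      simpa using hij
  · rw [key]
    intro i j i' j'
    refine Fin.cases ?_ (fun i => ?_) i <;> refine Fin.cases ?_ (fun j => ?_) j
    · intros; exact ⟨_, by rw [blk_00, one_mul]⟩
    · intro h; simp at h
    · intro h; simp at h
    · refine Fin.cases ?_ (fun i' => ?_) i' <;> refine Fin.cases ?_ (fun j' => ?_) j'
      · intro _ _ h; simp at h
      · intro _ h; simp at h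
      · intro _ h; simp at h
      · intro e1 e2 e3
        simp only [blk_ss]
        apply h2 <;> simp at * <;> omega

theorem adm_triv {m n : ℕ} {A : Matrix (Fin m) (Fin n) R} (h : ∀ i j, A i j = 0) : Adm' A := by
  have : A = 0 := by ext i j; exact h i j
  subst this
  exact ⟨1, 1, isUnit_one, isUnit_one, by simp, by simp⟩

variable [∀ I : Ideal R, I.IsTwoSided]

open Matrix in
theorem BD.main (H : BD R)
    (hG : ∀ a b : R, (∃ x y : R, a * x + b * y = 1) → ∃ y : R, IsPMRing (QuotBy (a + b * y))) :
    ∀ (m n : ℕ) (A : Matrix (Fin m) (Fin n) R), Adm' A := by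
  intro m
  induction m with
  | zero => intro n A; exact adm_triv fun i => i.elim0
  | succ m ih =>
    intro n A
    cases n with
    | zero => exact adm_triv fun i j => j.elim0
    | succ n =>
      obtain ⟨δ, x, y, A0, h1, h2⟩ := H.general hG (n + 1) (m + 1) A
      by_cases hδ : δ = 0
      · exact adm_triv fun i j => by rw [h2, hδ, zero_mul]
      · choose x' hx' using fun i => H.hR δ (x i)
        have h3 : x' ⬝ᵥ ((Matrix.of A0) *ᵥ y) = 1 := by
          apply mul_left_cancel₀ hδ
          rw [mul_one]
          nth_rewrite 2 [← h1]
          simp only [Matrix.mulVec, dotProduct, Matrix.of_apply, Finset.mul_sum, h2]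
          refine Finset.sum_congr rfl fun k _ => Finset.sum_congr rfl fun l _ => ?_
          rw [← mul_assoc, ← hx', mul_assoc, mul_assoc]
        obtain ⟨P, Q, B, hP, hQ, hB⟩ := H.step (Matrix.of A0) x' y h3
        exact H.adm_scale hδ h2 (adm_blk hP hQ hB (ih n B))

end

/-- Every Bézout duo-domain of Gelfand range 1 is an elementary divisor
ring: if whenever `aR + bR = R` there is `y` with `R/(a + by)R` a PM ring, then `R` is an
elementary divisor ring. -/
theorem stmt18 (R : Type*) [Ring R] [IsDomain R]
    (hB : IsBezoutRing R) (hD : IsDuoRing R)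
    (hG : ∀ a b : R, (∃ x y : R, a * x + b * y = 1) →
      ∃ y : R, IsPMRing (QuotBy (a + b * y))) :
    ElementaryDivisorRing R := by
  have H : BD R := BD.of hB hD
  haveI : ∀ I : Ideal R, I.IsTwoSided := H.twoSided
  intro m n A
  exact H.adm (H.main hG m n A)
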